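/- arXiv:1211.6355 — 2 statements merged into one kernel-verified Lean document; each statement's English description precedes it below -/
import Mathlib

section
/- Let Z = {P_1,...,P_m} ⊂ P^n be an arithmetically Gorenstein reduced set of points with reg(R/I_Z) = r, and let ℓ ∈ R_1 satisfy ℓ(P_i) ≠ 0 for all i. Let c_1,...,c_m be the (unique up to scalar) nonzero constants with Σ c_i ℓ(P_i) L_i^{r−1} = 0. Then ⟨I_Z, ℓ⟩ = Ann(c_1 L_1^r + ... + c_m L_m^r), the apolar annihilator in R of this degree-r form. -/
open MvPolynomial

/-- The differential operator on `K[y]` corresponding to the monomial `x^d`. -/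
noncomputable def diffMonomial {n : ℕ} (K : Type) [CommRing K] (d : Fin n →₀ ℕ) :
    Module.End K (MvPolynomial (Fin n) K) :=
  ((List.finRange n).map fun i => (((pderiv i : Derivation K (MvPolynomial (Fin n) K) (MvPolynomial (Fin n) K)).toLinearMap) ^ d i)).prod

/-- The apolarity action `f ∘ G` of `R = K[x]` on `S = K[y]` by partial differentiation. -/
noncomputable def apolar {n : ℕ} {K : Type} [CommRing K]
    (f G : MvPolynomial (Fin n) K) : MvPolynomial (Fin n) K :=
  f.support.sum fun d => f.coeff d • diffMonomial K d G

/-- The dual linear form `L = a_0 y_0 + ⋯ + a_n y_n` of a point with coordinates `a`. -/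
noncomputable def dualForm {n : ℕ} {K : Type} [CommRing K] (a : Fin n → K) :
    MvPolynomial (Fin n) K :=
  ∑ j, C (a j) * X j

/-- Hilbert function of `R/I` in degree `j`. -/
noncomputable def HF {n : ℕ} {K : Type} [Field K]
    (I : Ideal (MvPolynomial (Fin n) K)) (j : ℕ) : ℕ :=
  Module.finrank K ((homogeneousSubmodule (Fin n) K j).map (Ideal.Quotient.mkₐ K I).toLinearMap)

/-- The socle of `R/I`. -/
noncomputable def socle {n : ℕ} {K : Type} [Field K]
    (I : Ideal (MvPolynomial (Fin n) K)) : Submodule K (MvPolynomial (Fin n) K ⧸ I) :=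
  ⨅ i : Fin n, LinearMap.ker (LinearMap.mulLeft K (Ideal.Quotient.mk I (X i)))

/-- `R/I` is Artinian Gorenstein. -/
def ArtinianGorenstein {n : ℕ} {K : Type} [Field K]
    (I : Ideal (MvPolynomial (Fin n) K)) : Prop :=
  FiniteDimensional K (MvPolynomial (Fin n) K ⧸ I) ∧ Module.finrank K (socle I) = 1

section Apolarity

variable {n : ℕ} {K : Type}

lemma pderiv_dualForm [CommRing K] (a : Fin n → K) (i : Fin n) :
    pderiv i (dualForm a) = C (a i) := by
  classical
  simp [dualForm, map_sum, Derivation.leibniz, pderiv_X, Pi.single_apply]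

lemma pderiv_pow_dualForm_pow [CommRing K] (a : Fin n → K) (i : Fin n) (s k : ℕ) :
    ((pderiv i : Derivation K (MvPolynomial (Fin n) K) (MvPolynomial (Fin n) K)).toLinearMap ^ k)
        (dualForm a ^ s) =
      ((s.descFactorial k : K) * a i ^ k) • dualForm a ^ (s - k) := by
  induction k with
  | zero => simp
  | succ k ih =>
    rw [pow_succ', Module.End.mul_apply, ih, map_smul, Derivation.coeFn_coe,
      Derivation.leibniz_pow, pderiv_dualForm, Nat.descFactorial_succ,
      Nat.sub_sub]
    simp only [smul_eq_C_mul, smul_eq_mul, nsmul_eq_mul, map_mul, map_natCast, map_pow,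
      Nat.cast_mul]
    ring

lemma diffMonomial_dualForm_pow [CommRing K] (a : Fin n → K) (d : Fin n →₀ ℕ) (s : ℕ) :
    diffMonomial K d (dualForm a ^ s) =
      ((s.descFactorial d.degree : K) * ∏ i, a i ^ d i) • dualForm a ^ (s - d.degree) := by
  have key : ∀ l : List (Fin n),
      (l.map fun i => (pderiv i : Derivation K (MvPolynomial (Fin n) K)
        (MvPolynomial (Fin n) K)).toLinearMap ^ d i).prod (dualForm a ^ s) =
      ((s.descFactorial (l.map d).sum : K) * (l.map fun i => a i ^ d i).prod) •
        dualForm a ^ (s - (l.map d).sum) := by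
    intro l
    induction l with
    | nil => simp
    | cons i l ih =>
      simp only [List.map_cons, List.prod_cons, List.sum_cons, Module.End.mul_apply, ih, map_smul,
        pderiv_pow_dualForm_pow, smul_smul]
      rw [add_comm (d i), Nat.sub_sub, ← Nat.descFactorial_mul_descFactorial
        (Nat.le_add_right (l.map d).sum (d i)), Nat.add_sub_cancel_left]
      push_cast
      congr 1
      ring
  rw [diffMonomial, key, Finsupp.degree_eq_sum, Fin.sum_univ_def, Fin.prod_univ_def]

/-- The apolarity action as a linear map in the differential operator. -/
noncomputable def apolarₗ [CommRing K] (G : MvPolynomial (Fin n) K) :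
    MvPolynomial (Fin n) K →ₗ[K] MvPolynomial (Fin n) K :=
  (basisMonomials (Fin n) K).constr K fun d => diffMonomial K d G

lemma apolarₗ_apply [CommRing K] (f G : MvPolynomial (Fin n) K) : apolarₗ G f = apolar f G :=
  (basisMonomials (Fin n) K).constr_apply K _ f

lemma apolar_sum_smul [CommRing K] {ι : Type*} (s : Finset ι) (c : ι → K)
    (G : ι → MvPolynomial (Fin n) K) (f : MvPolynomial (Fin n) K) :
    apolar f (∑ i ∈ s, c i • G i) = ∑ i ∈ s, c i • apolar f (G i) := by
  simp only [apolar, map_sum, map_smul, Finset.smul_sum]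
  rw [Finset.sum_comm]
  exact Finset.sum_congr rfl fun i _ => Finset.sum_congr rfl fun d _ => smul_comm _ _ _

lemma apolar_dualForm_pow [CommRing K] (a : Fin n → K) (s k : ℕ) {f : MvPolynomial (Fin n) K}
    (hf : f.IsHomogeneous k) :
    apolar f (dualForm a ^ s) =
      ((s.descFactorial k : K) * eval a f) • dualForm a ^ (s - k) := by
  rw [eval_eq', Finset.mul_sum, Finset.sum_smul]
  refine Finset.sum_congr rfl fun d hd => ?_
  have hdk : d.degree = k := (hf.degree_eq_sum_deg_support hd).symm
  rw [diffMonomial_dualForm_pow, smul_smul, hdk]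
  congr 1
  ring

lemma MvPolynomial.IsHomogeneous.eval_smul [CommRing K] {f : MvPolynomial (Fin n) K} {k : ℕ}
    (hf : f.IsHomogeneous k) (t : K) (a : Fin n → K) : eval (t • a) f = t ^ k * eval a f := by
  simp only [eval_eq', Finset.mul_sum, Pi.smul_apply, smul_eq_mul, mul_pow,
    Finset.prod_mul_distrib, Finset.prod_pow_eq_pow_sum]
  refine Finset.sum_congr rfl fun d hd => ?_
  have hdk : d.degree = k := (hf.degree_eq_sum_deg_support hd).symm
  rw [← Finsupp.degree_eq_sum, hdk]
  ring

lemma eval_homogeneousComponent_eq_zero [Field K] [Infinite K] {f : MvPolynomial (Fin n) K}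
    {a : Fin n → K} (hf : ∀ t : K, eval (t • a) f = 0) (k : ℕ) :
    eval a (homogeneousComponent k f) = 0 := by
  let p : Polynomial K := ∑ j ∈ Finset.range (f.totalDegree + 1),
    Polynomial.monomial j (eval a (homogeneousComponent j f))
  have hp : p = 0 := by
    refine Polynomial.funext fun t => ?_
    rw [Polynomial.eval_zero, ← hf t]
    conv_rhs => rw [← sum_homogeneousComponent f]
    simp only [p, Polynomial.eval_finsetSum, Polynomial.eval_monomial, map_sum]
    refine Finset.sum_congr rfl fun j _ => ?_
    rw [(homogeneousComponent_isHomogeneous j f).eval_smul, mul_comm]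
  by_cases hk : k < f.totalDegree + 1
  · have := congrArg (Polynomial.coeff · k) hp
    simpa [p, Polynomial.finsetSum_coeff, Polynomial.coeff_monomial, hk] using this
  · rw [homogeneousComponent_eq_zero _ _ (by omega), map_zero]

lemma apolar_dualForm_pow_eq_zero [Field K] [Infinite K] {f : MvPolynomial (Fin n) K}
    {a : Fin n → K} (hf : ∀ t : K, eval (t • a) f = 0) (s : ℕ) :
    apolar f (dualForm a ^ s) = 0 := by
  rw [← apolarₗ_apply, ← sum_homogeneousComponent f, map_sum]
  refine Finset.sum_eq_zero fun k _ => ?_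
  rw [apolarₗ_apply, apolar_dualForm_pow a s k (homogeneousComponent_isHomogeneous k f),
    eval_homogeneousComponent_eq_zero hf, mul_zero, zero_smul]

end Apolarity

section Socle

variable {n : ℕ} {K : Type} [Field K]

lemma mk_mem_socle {B : Ideal (MvPolynomial (Fin n) K)} {f : MvPolynomial (Fin n) K} :
    Ideal.Quotient.mk B f ∈ socle B ↔ ∀ i, X i * f ∈ B := by
  simp [socle, Submodule.mem_iInf, ← map_mul, Ideal.Quotient.eq_zero_iff_mem]

lemma exists_mul_notMem_of_homogeneous_mem {B : Ideal (MvPolynomial (Fin n) K)} {k : ℕ}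
    (hB : ∀ g : MvPolynomial (Fin n) K, g.IsHomogeneous k → g ∈ B)
    {h : MvPolynomial (Fin n) K} (hh : h ∉ B) :
    ∃ g, g * h ∉ B ∧ ∀ i, X i * (g * h) ∈ B := by
  by_contra! hcon
  have key : ∀ j, ∃ g : MvPolynomial (Fin n) K, g.IsHomogeneous j ∧ g * h ∉ B := by
    intro j
    induction j with
    | zero => exact ⟨1, isHomogeneous_one _ _, by rwa [one_mul]⟩
    | succ j ih =>
      obtain ⟨g, hg, hgh⟩ := ih
      obtain ⟨i, hi⟩ := hcon g hgh
      exact ⟨X i * g, add_comm 1 j ▸ (isHomogeneous_X K i).mul hg, by rwa [mul_assoc]⟩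
  obtain ⟨g, hg, hgh⟩ := key k
  exact hgh (B.mul_mem_right h (hB g hg))

/-- An ideal strictly larger than `B` contains every representative of the socle of `R/B` when
that socle is one-dimensional and `B` contains all forms of some degree. -/
lemma mem_of_mk_mem_socle {B J : Ideal (MvPolynomial (Fin n) K)} {k : ℕ}
    (hB : ∀ g : MvPolynomial (Fin n) K, g.IsHomogeneous k → g ∈ B)
    (hsoc : Module.finrank K (socle B) = 1) (hBJ : B < J)
    {g : MvPolynomial (Fin n) K} (hg : Ideal.Quotient.mk B g ∈ socle B) : g ∈ J := by
  obtain ⟨h, hhJ, hhB⟩ := SetLike.exists_of_lt hBJ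
  obtain ⟨q, hq, hqX⟩ := exists_mul_notMem_of_homogeneous_mem hB hhB
  let v : socle B := ⟨Ideal.Quotient.mk B (q * h), mk_mem_socle.2 hqX⟩
  have hv : v ≠ 0 := fun hv => hq (Ideal.Quotient.eq_zero_iff_mem.1 (congrArg Subtype.val hv))
  obtain ⟨t, ht⟩ := (finrank_eq_one_iff_of_nonzero' v hv).1 hsoc ⟨_, hg⟩
  have ht' : Ideal.Quotient.mk B (t • (q * h)) = Ideal.Quotient.mk B g :=
    congrArg Subtype.val ht
  have hmem : t • (q * h) ∈ J := by
    rw [smul_eq_C_mul]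
    exact J.mul_mem_left _ (J.mul_mem_left _ hhJ)
  have := J.sub_mem hmem (hBJ.le (Ideal.Quotient.eq.1 ht'))
  rwa [sub_sub_cancel] at this

end Socle

section Points

variable {n m : ℕ} {K : Type} [Field K] {a : Fin m → Fin n → K}
  {I : Ideal (MvPolynomial (Fin n) K)}

lemma MvPolynomial.IsHomogeneous.mem_of_eval_eq_zero
    (hI : ∀ f, f ∈ I ↔ ∀ i, ∀ t : K, eval (t • a i) f = 0)
    {f : MvPolynomial (Fin n) K} {k : ℕ} (hf : f.IsHomogeneous k)
    (h : ∀ i, eval (a i) f = 0) : f ∈ I :=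
  (hI f).2 fun i t => by rw [hf.eval_smul, h, mul_zero]

/-- If the Hilbert function of the points attains their number in degree `r`, then forms of
degree `r` interpolate arbitrary values at the points. -/
lemma exists_isHomogeneous_eval_eq (hI : ∀ f, f ∈ I ↔ ∀ i, ∀ t : K, eval (t • a i) f = 0)
    {r : ℕ} (hr : HF I r = m) (v : Fin m → K) :
    ∃ f : MvPolynomial (Fin n) K, f.IsHomogeneous r ∧ ∀ i, eval (a i) f = v i := by
  let E : MvPolynomial (Fin n) K →ₗ[K] (Fin m → K) :=
    LinearMap.pi fun i => (aeval (a i)).toLinearMap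
  have hE : ∀ f i, E f i = eval (a i) f := fun f i => by simp [E, aeval_eq_eval]
  let H := homogeneousSubmodule (Fin n) K r
  let Q := (Ideal.Quotient.mkₐ K I).toLinearMap
  have hker : LinearMap.ker (Q.domRestrict H) = LinearMap.ker (E.domRestrict H) := by
    ext ⟨f, hf⟩
    simp only [LinearMap.mem_ker, LinearMap.domRestrict_apply]
    have hQ : Q f = 0 ↔ f ∈ I := Ideal.Quotient.eq_zero_iff_mem
    rw [hQ]
    constructor
    · intro h
      funext i
      have := (hI f).1 h i 1
      rwa [one_smul, ← hE] at this
    · intro h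
      exact ((mem_homogeneousSubmodule r f).1 hf).mem_of_eval_eq_zero hI fun i => by
        rw [← hE, h, Pi.zero_apply]
  have hrank : Module.finrank K (LinearMap.range (E.domRestrict H)) = m := by
    rw [← (E.domRestrict H).quotKerEquivRange.finrank_eq, ← hker,
      (Q.domRestrict H).quotKerEquivRange.finrank_eq, LinearMap.range_domRestrict]
    exact hr
  have htop : LinearMap.range (E.domRestrict H) = ⊤ :=
    Submodule.eq_top_of_finrank_eq (by rw [hrank, Module.finrank_fin_fun])
  obtain ⟨⟨f, hf⟩, hfv⟩ := LinearMap.range_eq_top.1 htop v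
  exact ⟨f, hf, fun i => by rw [← hE]; exact congrFun hfv i⟩

/-- The ideal of the points together with a linear form vanishing at none of them contains all
forms of degree one more than a degree in which forms interpolate at the points. -/
lemma mem_sup_span_of_isHomogeneous
    (hI : ∀ f, f ∈ I ↔ ∀ i, ∀ t : K, eval (t • a i) f = 0) {r : ℕ} (hr : HF I r = m)
    {ℓ : MvPolynomial (Fin n) K} (hℓ1 : ℓ.IsHomogeneous 1) (hℓ : ∀ i, eval (a i) ℓ ≠ 0)
    {g : MvPolynomial (Fin n) K} (hg : g.IsHomogeneous (r + 1)) :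
    g ∈ I ⊔ Ideal.span {ℓ} := by
  obtain ⟨f, hf, hfv⟩ := exists_isHomogeneous_eval_eq hI hr
    fun i => eval (a i) g / eval (a i) ℓ
  have hmem : g - f * ℓ ∈ I := by
    refine (hg.sub (hf.mul hℓ1)).mem_of_eval_eq_zero hI fun i => ?_
    rw [map_sub, map_mul, hfv, div_mul_cancel₀ _ (hℓ i), sub_self]
  rw [← sub_add_cancel g (f * ℓ)]
  exact add_mem (Ideal.mem_sup_left hmem)
    (Ideal.mem_sup_right (Ideal.mul_mem_left _ f (Ideal.mem_span_singleton_self ℓ)))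

end Points

/-- main theorem, direct implication: for an arithmetically Gorenstein reduced
set of points of regularity `r`, a linear form `ℓ` nonvanishing at the points, and nonzero
constants `c_i` with `∑ c_i ℓ(P_i) L_i^{r−1} = 0`, one has
`⟨I_Z, ℓ⟩ = Ann(c_1 L_1^r + ⋯ + c_m L_m^r)`. -/
theorem main_theorem_direct (K : Type) [Field K] [CharZero K] (n m : ℕ)
    (a : Fin m → Fin (n + 1) → K) (ha : ∀ i, a i ≠ 0)
    (hdist : ∀ i j, i ≠ j → ∀ t : K, a i ≠ t • a j)
    (I : Ideal (MvPolynomial (Fin (n + 1)) K))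
    (hI : ∀ f, f ∈ I ↔ ∀ i, ∀ t : K, eval (t • a i) f = 0)
    (hAG : ∀ ℓ' ∈ homogeneousSubmodule (Fin (n + 1)) K 1,
      (∀ i, eval (a i) ℓ' ≠ 0) → ArtinianGorenstein (I ⊔ Ideal.span {ℓ'}))
    (r : ℕ) (hreg : IsLeast {j : ℕ | HF I j = m} r)
    (ℓ : MvPolynomial (Fin (n + 1)) K) (hℓ1 : ℓ ∈ homogeneousSubmodule (Fin (n + 1)) K 1)
    (hℓ : ∀ i, eval (a i) ℓ ≠ 0)
    (c : Fin m → K) (hc : ∀ i, c i ≠ 0)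
    (hrel : (∑ i, (c i * eval (a i) ℓ) • dualForm (a i) ^ (r - 1)) = 0)
    (J : Ideal (MvPolynomial (Fin (n + 1)) K))
    (hJ : ∀ f, f ∈ J ↔ apolar f (∑ i, c i • dualForm (a i) ^ r) = 0) :
    I ⊔ Ideal.span {ℓ} = J := by
  have hBJ : I ⊔ Ideal.span {ℓ} ≤ J := by
    refine sup_le (fun f hf => ?_) ((Ideal.span_singleton_le_iff_mem J).2 ?_)
    · rw [hJ, apolar_sum_smul]
      refine Finset.sum_eq_zero fun i _ => ?_
      rw [apolar_dualForm_pow_eq_zero ((hI f).1 hf i), smul_zero]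
    · rw [hJ, apolar_sum_smul, ← smul_zero (r : K), ← hrel, Finset.smul_sum]
      refine Finset.sum_congr rfl fun i _ => ?_
      rw [apolar_dualForm_pow (a i) r 1 hℓ1, Nat.descFactorial_one, smul_smul, smul_smul]
      congr 1
      ring
  by_contra hne
  have hdeg : ∀ g : MvPolynomial (Fin (n + 1)) K, g.IsHomogeneous (r + 1) →
      g ∈ I ⊔ Ideal.span {ℓ} := fun g hg => mem_sup_span_of_isHomogeneous hI hreg.1 hℓ1 hℓ hg
  have hsoc := (hAG ℓ hℓ1 hℓ).2
  have hforms : ∀ g : MvPolynomial (Fin (n + 1)) K, g.IsHomogeneous r → g ∈ J := fun g hg =>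
    mem_of_mk_mem_socle hdeg hsoc (lt_of_le_of_ne hBJ hne)
      (mk_mem_socle.2 fun i => hdeg _ (add_comm 1 r ▸ (isHomogeneous_X K i).mul hg))
  rcases isEmpty_or_nonempty (Fin m) with hm | ⟨⟨i₀⟩⟩
  · have hItop : I = ⊤ := I.eq_top_iff_one.2 ((hI 1).2 fun i => hm.elim i)
    rw [hItop, top_sup_eq] at hBJ hne
    exact hne (top_le_iff.1 hBJ).symm
  · obtain ⟨g, hg, hgv⟩ := exists_isHomogeneous_eval_eq hI hreg.1 (Pi.single i₀ 1)
    have h0 := (hJ g).1 (hforms g hg)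
    rw [apolar_sum_smul, Finset.sum_eq_single i₀, apolar_dualForm_pow (a i₀) r r hg, hgv,
      Nat.descFactorial_self, Nat.sub_self, pow_zero, smul_smul, Pi.single_eq_same] at h0
    · simp [hc, Nat.factorial_ne_zero] at h0
    · intro i _ hi
      rw [apolar_dualForm_pow (a i) r r hg, hgv, Pi.single_eq_of_ne hi, mul_zero, zero_smul,
        smul_zero]
    · simp
end

section
/- Let Z = {P_1,...,P_m} ⊂ P^n be the points dual to linear forms L_1,...,L_m satisfying: (1) L_1^r,...,L_m^r linearly independent; (2) there exist unique-up-to-scalar nonzero d_1,...,d_m with Σ d_i L_i^{r−1} = 0. If the h-vector of Z is symmetric, then Z is arithmetically Gorenstein with reg(R/I_Z) = r. -/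
open MvPolynomial

/-! ### Evaluation at a finite family of points -/

/-- Evaluation of polynomials at the points `a i`. -/
noncomputable def evalPoints {K : Type} [Field K] {k m : ℕ} (a : Fin m → Fin k → K) :
    MvPolynomial (Fin k) K →ₐ[K] (Fin m → K) :=
  AlgHom.pi fun i => aeval (a i)

/-- The vectors of values of the forms of degree `j` at the points `a i`. -/
noncomputable def formValues {K : Type} [Field K] {k m : ℕ} (a : Fin m → Fin k → K) (j : ℕ) :
    Submodule K (Fin m → K) :=
  (homogeneousSubmodule (Fin k) K j).map (evalPoints a).toLinearMap

/-- The vectors of values of the forms of degree `j` that are multiples of `ℓ`, for a linear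
form `ℓ`. -/
noncomputable def multipleValues {K : Type} [Field K] {k m : ℕ} (a : Fin m → Fin k → K)
    (ℓ : MvPolynomial (Fin k) K) : ℕ → Submodule K (Fin m → K)
  | 0 => ⊥
  | j + 1 => (formValues a j).map (LinearMap.mulLeft K (evalPoints a ℓ))

/-- The bilinear form on `K^m` with diagonal Gram matrix. -/
noncomputable def diagForm {K : Type} [Field K] {m : ℕ} (d : Fin m → K) :
    LinearMap.BilinForm K (Fin m → K) :=
  LinearMap.mk₂ K (fun u v => ∑ i, d i * (u i * v i))
    (fun u v w => by simp [add_mul, mul_add, Finset.sum_add_distrib])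
    (fun c u v => by
      simp only [Pi.smul_apply, smul_eq_mul, Finset.mul_sum]
      exact Finset.sum_congr rfl fun i _ => by ring)
    (fun u v w => by simp [mul_add, Finset.sum_add_distrib])
    (fun c u v => by
      simp only [Pi.smul_apply, smul_eq_mul, Finset.mul_sum]
      exact Finset.sum_congr rfl fun i _ => by ring)

section EvalPoints

variable {K : Type} [Field K] {k m : ℕ}

@[simp]
lemma evalPoints_apply (a : Fin m → Fin k → K) (f : MvPolynomial (Fin k) K) (i : Fin m) :
    evalPoints a f i = eval (a i) f := by
  simp [evalPoints, aeval_eq_eval]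

lemma evalPoints_mem_formValues (a : Fin m → Fin k → K) {f : MvPolynomial (Fin k) K} {j : ℕ}
    (hf : f ∈ homogeneousSubmodule (Fin k) K j) : evalPoints a f ∈ formValues a j :=
  Submodule.mem_map_of_mem (f := (evalPoints a).toLinearMap) hf

lemma mul_mem_formValues {a : Fin m → Fin k → K} {u v : Fin m → K} {i j : ℕ}
    (hu : u ∈ formValues a i) (hv : v ∈ formValues a j) : u * v ∈ formValues a (i + j) := by
  obtain ⟨f, hf, rfl⟩ := hu
  obtain ⟨g, hg, rfl⟩ := hv
  have := evalPoints_mem_formValues a (f := f * g)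
    (((mem_homogeneousSubmodule i f).1 hf).mul ((mem_homogeneousSubmodule j g).1 hg))
  simpa using this

lemma multipleValues_le (a : Fin m → Fin k → K) {ℓ : MvPolynomial (Fin k) K}
    (hℓ : ℓ ∈ homogeneousSubmodule (Fin k) K 1) (j : ℕ) :
    multipleValues a ℓ j ≤ formValues a j := by
  cases j with
  | zero => exact bot_le
  | succ j =>
    rintro _ ⟨v, hv, rfl⟩
    rw [add_comm j 1]
    exact mul_mem_formValues (evalPoints_mem_formValues a hℓ) hv

lemma finrank_multipleValues_succ (a : Fin m → Fin k → K) {ℓ : MvPolynomial (Fin k) K}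
    (hℓ : ∀ i, eval (a i) ℓ ≠ 0) (j : ℕ) :
    Module.finrank K (multipleValues a ℓ (j + 1)) = Module.finrank K (formValues a j) := by
  refine (Submodule.equivMapOfInjective _ ?_ _).finrank_eq.symm
  intro u v huv
  funext i
  have := congrFun huv i
  simpa [hℓ i] using this

lemma eval_smul_of_mem_homogeneousSubmodule {f : MvPolynomial (Fin k) K} {j : ℕ}
    (hf : f ∈ homogeneousSubmodule (Fin k) K j) (t : K) (b : Fin k → K) :
    eval (t • b) f = t ^ j * eval b f := by
  rw [eval_eq', eval_eq', Finset.mul_sum]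
  refine Finset.sum_congr rfl fun s hs => ?_
  have hs' : s.degree = j := by
    have := (mem_homogeneousSubmodule j f).1 hf (mem_support_iff.1 hs)
    rwa [Finsupp.degree_eq_weight_one]
  simp only [Pi.smul_apply, smul_eq_mul, mul_pow, Finset.prod_mul_distrib,
    Finset.prod_pow_eq_pow_sum]
  rw [← Finsupp.degree_eq_sum, hs']
  ring

lemma sum_smul_dualForm_pow_eq_zero_iff [CharZero K] (a : Fin m → Fin k → K) (e : Fin m → K)
    (j : ℕ) :
    ∑ i, e i • dualForm (a i) ^ j = 0 ↔ ∀ v ∈ formValues a j, ∑ i, e i * v i = 0 := by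
  have hcoeff (s : Fin k →₀ ℕ) : coeff s (∑ i, e i • dualForm (a i) ^ j) =
      if s.degree = j then s.multinomial * ∑ i, e i * ∏ x, a i x ^ s x else 0 := by
    have hdual (i : Fin m) : dualForm (a i) = ∑ x, a i x • (X x : MvPolynomial (Fin k) K) := by
      simp [dualForm, smul_eq_C_mul]
    simp only [coeff_sum, coeff_smul, hdual, coeff_linearCombination_X_pow_of_fintype]
    have hdeg : (s.sum fun _ m => m) = s.degree := rfl
    rw [hdeg]
    split_ifs
    · rw [Finset.mul_sum]
      refine Finset.sum_congr rfl fun i _ => ?_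
      rw [Finsupp.prod_fintype _ _ (by simp), smul_eq_mul]
      ring
    · simp
  constructor
  · rintro h _ ⟨f, hf, rfl⟩
    have hf' : f ∈ homogeneousSubmodule (Fin k) K j := hf
    simp only [AlgHom.toLinearMap_apply, evalPoints_apply, eval_eq', Finset.mul_sum]
    rw [Finset.sum_comm]
    refine Finset.sum_eq_zero fun s hs => ?_
    have hs' : s.degree = j := by
      have := (mem_homogeneousSubmodule j f).1 hf' (mem_support_iff.1 hs)
      rwa [Finsupp.degree_eq_weight_one]
    have h0 := hcoeff s
    rw [h, if_pos hs', coeff_zero, eq_comm, mul_eq_zero] at h0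
    have hne : (s.multinomial : K) ≠ 0 := by
      exact_mod_cast (Nat.multinomial_pos _ _).ne'
    have h1 := h0.resolve_left hne
    simp only [mul_left_comm (e _), ← Finset.mul_sum, h1, mul_zero]
  · intro h
    ext s
    rw [hcoeff, coeff_zero]
    split_ifs with hs
    · have := h _ (evalPoints_mem_formValues a (f := monomial s 1)
        ((mem_homogeneousSubmodule j _).2 (isHomogeneous_monomial 1 hs)))
      simp only [evalPoints_apply, eval_monomial, one_mul] at this
      simp only [Finsupp.prod_fintype, pow_zero, implies_true] at this
      rw [this, mul_zero]
    · rfl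

lemma diagForm_apply (d u v : Fin m → K) : diagForm d u v = ∑ i, d i * (u i * v i) := rfl

lemma diagForm_nondegenerate {d : Fin m → K} (hd : ∀ i, d i ≠ 0) :
    (diagForm d).Nondegenerate := by
  constructor
  · intro u hu
    funext i
    simpa [diagForm_apply, Pi.single_apply, hd i] using hu (Pi.single i 1)
  · intro u hu
    funext i
    simpa [diagForm_apply, Pi.single_apply, hd i] using hu (Pi.single i 1)

lemma finrank_formValues_add_finrank_orthogonal {a : Fin m → Fin k → K} {d : Fin m → K}
    (hd : ∀ i, d i ≠ 0) (j : ℕ) :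
    Module.finrank K (formValues a j) +
      Module.finrank K ((diagForm d).orthogonal (formValues a j)) = m := by
  have := LinearMap.BilinForm.finrank_orthogonal (diagForm_nondegenerate hd) (formValues a j)
  have hle := Submodule.finrank_le (formValues a j)
  rw [Module.finrank_fin_fun] at this hle
  omega

end EvalPoints

section Homogeneous

variable {K : Type} [Field K] {k m : ℕ}

lemma homogeneousComponent_mul_left {ℓ : MvPolynomial (Fin k) K}
    (hℓ : ℓ ∈ homogeneousSubmodule (Fin k) K 1) (q : MvPolynomial (Fin k) K) (j : ℕ) :
    homogeneousComponent (j + 1) (ℓ * q) = ℓ * homogeneousComponent j q := by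
  conv_lhs => rw [← sum_homogeneousComponent q]
  have hmem (i : ℕ) : ℓ * homogeneousComponent i q ∈ homogeneousSubmodule (Fin k) K (i + 1) := by
    rw [add_comm i 1]
    exact IsHomogeneous.mul hℓ (homogeneousComponent_isHomogeneous i q)
  rw [Finset.mul_sum, map_sum]
  simp only [homogeneousComponent_of_mem (hmem _), add_left_inj]
  rw [Finset.sum_ite_eq]
  split_ifs with h
  · rfl
  · rw [homogeneousComponent_eq_zero _ _ (by simpa using h), mul_zero]

lemma homogeneousComponent_zero_mul_left {ℓ : MvPolynomial (Fin k) K}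
    (hℓ : ℓ ∈ homogeneousSubmodule (Fin k) K 1) (q : MvPolynomial (Fin k) K) :
    homogeneousComponent 0 (ℓ * q) = 0 := by
  have h : coeff 0 ℓ = 0 := by
    by_contra h
    simpa using hℓ h
  have h' : constantCoeff ℓ = 0 := h
  rw [homogeneousComponent_zero]
  change C (constantCoeff (ℓ * q)) = 0
  rw [map_mul, h', zero_mul, map_zero]

/-- A linear map on a submodule has a rank that depends only on its kernel there. -/
lemma finrank_map_eq_of_eq_zero_iff {E F G : Type} [AddCommGroup E] [Module K E]
    [AddCommGroup F] [Module K F] [AddCommGroup G] [Module K G] (S : Submodule K E)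
    (f : E →ₗ[K] F) (g : E →ₗ[K] G) (h : ∀ x ∈ S, f x = 0 ↔ g x = 0) :
    Module.finrank K (S.map f) = Module.finrank K (S.map g) := by
  have hker : LinearMap.ker (f.domRestrict S) = LinearMap.ker (g.domRestrict S) := by
    ext x
    simpa using h x x.2
  rw [← LinearMap.range_domRestrict, ← LinearMap.range_domRestrict]
  exact (((f.domRestrict S).quotKerEquivRange.symm.trans
    (Submodule.quotEquivOfEq _ _ hker)).trans (g.domRestrict S).quotKerEquivRange).finrank_eq

lemma finrank_map_mkQ_add {E : Type} [AddCommGroup E] [Module K E] [FiniteDimensional K E]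
    {W V : Submodule K E} (h : W ≤ V) :
    Module.finrank K (V.map W.mkQ) + Module.finrank K W = Module.finrank K V := by
  have := LinearMap.finrank_range_add_finrank_ker (W.mkQ.domRestrict V)
  rw [LinearMap.range_domRestrict, LinearMap.ker_domRestrict, Submodule.ker_mkQ] at this
  exact (Submodule.submoduleOfEquivOfLe h).finrank_eq ▸ this

end Homogeneous

section IdealOfPoints

variable {K : Type} [Field K] {k m : ℕ}
  {a : Fin m → Fin k → K} {I : Ideal (MvPolynomial (Fin k) K)}

lemma mem_ideal_iff_evalPoints_eq_zero (hI : ∀ f, f ∈ I ↔ ∀ i, ∀ t : K, eval (t • a i) f = 0)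
    {f : MvPolynomial (Fin k) K} {j : ℕ} (hf : f ∈ homogeneousSubmodule (Fin k) K j) :
    f ∈ I ↔ evalPoints a f = 0 := by
  rw [hI]
  constructor
  · intro h
    funext i
    simpa using h i 1
  · intro h i t
    have := congrFun h i
    rw [evalPoints_apply] at this
    rw [eval_smul_of_mem_homogeneousSubmodule hf, this, Pi.zero_apply, mul_zero]

lemma homogeneousComponent_mem_ideal [Infinite K]
    (hI : ∀ f, f ∈ I ↔ ∀ i, ∀ t : K, eval (t • a i) f = 0)
    {f : MvPolynomial (Fin k) K} (hf : f ∈ I) (j : ℕ) : homogeneousComponent j f ∈ I := by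
  rw [mem_ideal_iff_evalPoints_eq_zero hI (homogeneousComponent_mem j f)]
  funext i
  set p : Polynomial K := ∑ l ∈ Finset.range (f.totalDegree + 1),
    Polynomial.monomial l (eval (a i) (homogeneousComponent l f)) with hp
  have hp0 : p = 0 := by
    refine Polynomial.funext fun t => ?_
    rw [hp, Polynomial.eval_finsetSum, Polynomial.eval_zero, ← (hI f).1 hf i t]
    conv_rhs => rw [← sum_homogeneousComponent f]
    rw [map_sum]
    refine Finset.sum_congr rfl fun l _ => ?_
    rw [Polynomial.eval_monomial,
      eval_smul_of_mem_homogeneousSubmodule (homogeneousComponent_mem l f), mul_comm]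
  have hj : p.coeff j = 0 := by rw [hp0, Polynomial.coeff_zero]
  rw [evalPoints_apply, Pi.zero_apply]
  by_cases hjd : j ∈ Finset.range (f.totalDegree + 1)
  · rw [hp, Polynomial.finsetSum_coeff] at hj
    simp only [Polynomial.coeff_monomial, Finset.sum_ite_eq', hjd, if_true] at hj
    exact hj
  · rw [homogeneousComponent_eq_zero _ _ (by simpa using hjd), map_zero]

lemma homogeneousComponent_mem_sup_span [Infinite K]
    (hI : ∀ f, f ∈ I ↔ ∀ i, ∀ t : K, eval (t • a i) f = 0)
    {ℓ : MvPolynomial (Fin k) K} (hℓ : ℓ ∈ homogeneousSubmodule (Fin k) K 1)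
    {f : MvPolynomial (Fin k) K} (hf : f ∈ I ⊔ Ideal.span {ℓ}) (j : ℕ) :
    homogeneousComponent j f ∈ I ⊔ Ideal.span {ℓ} := by
  obtain ⟨g, hg, h, hh, rfl⟩ := Submodule.mem_sup.1 hf
  obtain ⟨q, rfl⟩ := Ideal.mem_span_singleton.1 hh
  rw [map_add]
  refine add_mem (Ideal.mem_sup_left (homogeneousComponent_mem_ideal hI hg j))
    (Ideal.mem_sup_right (Ideal.mem_span_singleton.2 ?_))
  cases j with
  | zero => rw [homogeneousComponent_zero_mul_left hℓ]; exact dvd_zero _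
  | succ j => rw [homogeneousComponent_mul_left hℓ]; exact dvd_mul_right _ _

lemma mem_sup_span_iff [Infinite K] (hI : ∀ f, f ∈ I ↔ ∀ i, ∀ t : K, eval (t • a i) f = 0)
    {ℓ : MvPolynomial (Fin k) K} (hℓ : ℓ ∈ homogeneousSubmodule (Fin k) K 1)
    {f : MvPolynomial (Fin k) K} {j : ℕ} (hf : f ∈ homogeneousSubmodule (Fin k) K j) :
    f ∈ I ⊔ Ideal.span {ℓ} ↔ evalPoints a f ∈ multipleValues a ℓ j := by
  constructor
  · intro h
    obtain ⟨g, hg, q', hq, rfl⟩ := Submodule.mem_sup.1 h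
    obtain ⟨q, rfl⟩ := Ideal.mem_span_singleton.1 hq
    have hgj := (mem_ideal_iff_evalPoints_eq_zero hI (homogeneousComponent_mem j g)).1
      (homogeneousComponent_mem_ideal hI hg j)
    rw [← homogeneousComponent_eq_self ((mem_homogeneousSubmodule j _).1 hf), map_add, map_add,
      hgj, zero_add]
    cases j with
    | zero => rw [homogeneousComponent_zero_mul_left hℓ, map_zero]; exact zero_mem _
    | succ j =>
      rw [homogeneousComponent_mul_left hℓ, map_mul]
      exact Submodule.mem_map_of_mem (f := LinearMap.mulLeft K (evalPoints a ℓ))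
        (evalPoints_mem_formValues a (homogeneousComponent_mem j q))
  · intro h
    cases j with
    | zero =>
      exact Ideal.mem_sup_left ((mem_ideal_iff_evalPoints_eq_zero hI hf).2 ((Submodule.mem_bot K).1 h))
    | succ j =>
      obtain ⟨_, ⟨q, hq, rfl⟩, hv⟩ := h
      have hq' : q ∈ homogeneousSubmodule (Fin k) K j := hq
      have hℓq : ℓ * q ∈ homogeneousSubmodule (Fin k) K (j + 1) := by
        rw [add_comm j 1]
        exact IsHomogeneous.mul hℓ hq'
      have hsub : f - ℓ * q ∈ I := by
        rw [mem_ideal_iff_evalPoints_eq_zero hI (sub_mem hf hℓq), map_sub, map_mul, ← hv]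
        exact sub_self _
      rw [← sub_add_cancel f (ℓ * q)]
      exact add_mem (Ideal.mem_sup_left hsub)
        (Ideal.mem_sup_right (Ideal.mem_span_singleton.2 (dvd_mul_right _ _)))

lemma HF_eq_finrank_formValues (hI : ∀ f, f ∈ I ↔ ∀ i, ∀ t : K, eval (t • a i) f = 0) (j : ℕ) :
    HF I j = Module.finrank K (formValues a j) := by
  refine finrank_map_eq_of_eq_zero_iff _ _ _ fun f hf => ?_
  simpa [Ideal.Quotient.eq_zero_iff_mem] using mem_ideal_iff_evalPoints_eq_zero hI hf

lemma HF_sup_span_add [Infinite K] (hI : ∀ f, f ∈ I ↔ ∀ i, ∀ t : K, eval (t • a i) f = 0)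
    {ℓ : MvPolynomial (Fin k) K} (hℓ : ℓ ∈ homogeneousSubmodule (Fin k) K 1) (j : ℕ) :
    HF (I ⊔ Ideal.span {ℓ}) j + Module.finrank K (multipleValues a ℓ j) =
      Module.finrank K (formValues a j) := by
  rw [← finrank_map_mkQ_add (multipleValues_le a hℓ j)]
  congr 1
  rw [formValues, ← Submodule.map_comp]
  refine finrank_map_eq_of_eq_zero_iff _ _ _ fun f hf => ?_
  simpa [Ideal.Quotient.eq_zero_iff_mem] using mem_sup_span_iff hI hℓ hf

lemma sum_range_HF_sup_span [Infinite K]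
    (hI : ∀ f, f ∈ I ↔ ∀ i, ∀ t : K, eval (t • a i) f = 0)
    {ℓ : MvPolynomial (Fin k) K} (hℓ : ℓ ∈ homogeneousSubmodule (Fin k) K 1)
    (hℓ0 : ∀ i, eval (a i) ℓ ≠ 0) (j : ℕ) :
    ∑ l ∈ Finset.range (j + 1), HF (I ⊔ Ideal.span {ℓ}) l =
      Module.finrank K (formValues a j) := by
  induction j with
  | zero =>
    have h0 : Module.finrank K (multipleValues a ℓ 0) = 0 := finrank_bot K _
    rw [← HF_sup_span_add hI hℓ 0, h0, zero_add, Finset.sum_range_one, add_zero]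
  | succ j ih =>
    rw [Finset.sum_range_succ, ih, ← HF_sup_span_add hI hℓ (j + 1),
      finrank_multipleValues_succ a hℓ0, add_comm]

lemma monotone_finrank_formValues {ℓ : MvPolynomial (Fin k) K}
    (hℓ : ℓ ∈ homogeneousSubmodule (Fin k) K 1) (hℓ0 : ∀ i, eval (a i) ℓ ≠ 0) :
    Monotone fun j => Module.finrank K (formValues a j) := by
  refine monotone_nat_of_le_succ fun j => ?_
  rw [← finrank_multipleValues_succ a hℓ0]
  exact Submodule.finrank_mono (multipleValues_le a hℓ (j + 1))

end IdealOfPoints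

lemma mem_ideal_of_homogeneousComponent_mem {K : Type} [Field K] {k : ℕ}
    {J : Ideal (MvPolynomial (Fin k) K)} {f : MvPolynomial (Fin k) K}
    (h : ∀ j, homogeneousComponent j f ∈ J) : f ∈ J := by
  rw [← sum_homogeneousComponent f]
  exact Submodule.sum_mem _ fun j _ => h j

/-- If `J` contains all forms of degree greater than `r`, then `R/J` is finite dimensional. -/
lemma finiteDimensional_quotient_of_homogeneousSubmodule_le {K : Type} [Field K] {k : ℕ}
    {J : Ideal (MvPolynomial (Fin k) K)} {r : ℕ}
    (hJ : ∀ j, r < j → ∀ f ∈ homogeneousSubmodule (Fin k) K j, f ∈ J) :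
    FiniteDimensional K (MvPolynomial (Fin k) K ⧸ J) := by
  refine Module.Finite.of_surjective
    ((Ideal.Quotient.mkₐ K J).toLinearMap.domRestrict (restrictTotalDegree (Fin k) K r)) ?_
  intro y
  obtain ⟨f, rfl⟩ := Ideal.Quotient.mk_surjective y
  refine ⟨⟨∑ i ∈ Finset.range (r + 1), homogeneousComponent i f, ?_⟩, ?_⟩
  · refine Submodule.sum_mem _ fun i hi => ?_
    rw [mem_restrictTotalDegree]
    exact (homogeneousComponent_isHomogeneous i f).totalDegree_le.trans
      (Nat.lt_succ_iff.1 (Finset.mem_range.1 hi))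
  · symm
    change Ideal.Quotient.mk J _ = Ideal.Quotient.mk J _
    rw [Ideal.Quotient.eq]
    change f - ∑ i ∈ Finset.range (r + 1), homogeneousComponent i f ∈ J
    refine mem_ideal_of_homogeneousComponent_mem fun j => ?_
    rw [map_sub, map_sum]
    simp only [homogeneousComponent_of_mem (homogeneousComponent_mem _ f), Finset.sum_ite_eq]
    split_ifs with h
    · rw [sub_self]; exact zero_mem _
    · rw [sub_zero]
      exact hJ j (by simpa using h) _ (homogeneousComponent_mem j f)

/-- The socle of a graded quotient `R/J` is its component of degree `r` if it has no socle
elements in other degrees and vanishes in degree `r + 1`. -/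
lemma socle_eq_map_homogeneousSubmodule {K : Type} [Field K] {k : ℕ}
    {J : Ideal (MvPolynomial (Fin k) K)} {r : ℕ}
    (hhom : ∀ f ∈ J, ∀ j, homogeneousComponent j f ∈ J)
    (hsocle : ∀ j, j ≠ r → ∀ f ∈ homogeneousSubmodule (Fin k) K j, (∀ x, X x * f ∈ J) → f ∈ J)
    (hJ : ∀ f ∈ homogeneousSubmodule (Fin k) K (r + 1), f ∈ J) :
    socle J = (homogeneousSubmodule (Fin k) K r).map (Ideal.Quotient.mkₐ K J).toLinearMap := by
  have hX (x : Fin k) : (X x : MvPolynomial (Fin k) K) ∈ homogeneousSubmodule (Fin k) K 1 :=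
    isHomogeneous_X K x
  ext y
  obtain ⟨f, rfl⟩ := Ideal.Quotient.mk_surjective y
  have hmem : Ideal.Quotient.mk J f ∈ socle J ↔ ∀ x, X x * f ∈ J := by
    simp [socle, Submodule.mem_iInf, ← map_mul, Ideal.Quotient.eq_zero_iff_mem]
  rw [hmem]
  constructor
  · intro h
    refine ⟨homogeneousComponent r f, homogeneousComponent_mem r f, Eq.symm ?_⟩
    change Ideal.Quotient.mk J _ = Ideal.Quotient.mk J _
    rw [Ideal.Quotient.eq]
    refine mem_ideal_of_homogeneousComponent_mem fun j => ?_
    rw [map_sub, homogeneousComponent_of_mem (homogeneousComponent_mem r f)]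
    split_ifs with hj
    · rw [hj, sub_self]; exact zero_mem _
    · rw [sub_zero]
      refine hsocle j hj _ (homogeneousComponent_mem j f) fun x => ?_
      rw [← homogeneousComponent_mul_left (hX x)]
      exact hhom _ (h x) _
  · rintro ⟨g, hg, hgf⟩ x
    have hg' : g ∈ homogeneousSubmodule (Fin k) K r := hg
    have hgf' : g - f ∈ J := (Ideal.Quotient.eq).1 hgf
    have hXg : X x * g ∈ J := hJ _ (by rw [add_comm]; exact IsHomogeneous.mul (hX x) hg')
    have := sub_mem hXg (J.mul_mem_left (X x) hgf')
    rwa [← mul_sub, sub_sub_cancel] at this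

section Duality

variable {K : Type} [Field K] [CharZero K] {k m : ℕ} {a : Fin m → Fin k → K} {d : Fin m → K}

lemma mem_orthogonal_formValues_iff {e : Fin m → K} {j : ℕ} :
    e ∈ (diagForm d).orthogonal (formValues a j) ↔
      ∑ i, (d i * e i) • dualForm (a i) ^ j = 0 := by
  rw [sum_smul_dualForm_pow_eq_zero_iff a (fun i => d i * e i),
    LinearMap.BilinForm.mem_orthogonal_iff]
  simp only [diagForm_apply, mul_comm _ (e _), mul_assoc, mul_left_comm (e _) (d _)]

lemma formValues_eq_top (hd : ∀ i, d i ≠ 0) {r : ℕ}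
    (h1 : LinearIndependent K fun i => dualForm (a i) ^ r) : formValues a r = ⊤ := by
  have hbot : (diagForm d).orthogonal (formValues a r) = ⊥ := by
    rw [Submodule.eq_bot_iff]
    intro e he
    have := Fintype.linearIndependent_iff.1 h1 _ (mem_orthogonal_formValues_iff.1 he)
    funext i
    exact (mul_eq_zero.1 (this i)).resolve_left (hd i)
  have := finrank_formValues_add_finrank_orthogonal (a := a) hd r
  rw [hbot, finrank_bot, add_zero] at this
  exact Submodule.eq_top_of_finrank_eq (by rw [this, Module.finrank_fin_fun])

lemma finrank_formValues_add_one (hd : ∀ i, d i ≠ 0) (hm : 0 < m) {q : ℕ}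
    (hrel : ∑ i, d i • dualForm (a i) ^ q = 0)
    (huniq : ∀ e : Fin m → K, ∑ i, e i • dualForm (a i) ^ q = 0 → ∃ t : K, ∀ i, e i = t * d i) :
    Module.finrank K (formValues a q) + 1 = m := by
  have hspan : (diagForm d).orthogonal (formValues a q) = K ∙ (1 : Fin m → K) := by
    ext e
    rw [mem_orthogonal_formValues_iff, Submodule.mem_span_singleton]
    constructor
    · intro h
      obtain ⟨t, ht⟩ := huniq _ h
      refine ⟨t, funext fun i => ?_⟩
      have := ht i
      rw [mul_comm] at this
      simpa using (mul_right_cancel₀ (hd i) this).symm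
    · rintro ⟨t, rfl⟩
      simp only [Pi.smul_apply, Pi.one_apply, smul_eq_mul, mul_one, mul_comm (d _) t, mul_smul,
        ← Finset.smul_sum, hrel, smul_zero]
  have hone : (1 : Fin m → K) ≠ 0 := fun h => one_ne_zero (congrFun h ⟨0, hm⟩)
  have := finrank_formValues_add_finrank_orthogonal (a := a) hd q
  rwa [hspan, finrank_span_singleton hone] at this

/-- Forms of complementary degrees are orthogonal, and exactly so if the dimensions match. -/
lemma orthogonal_formValues (hd : ∀ i, d i ≠ 0) {i j q : ℕ} (hij : i + j = q)
    (hrel : ∑ i, d i • dualForm (a i) ^ q = 0)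
    (hdim : Module.finrank K (formValues a i) + Module.finrank K (formValues a j) = m) :
    (diagForm d).orthogonal (formValues a i) = formValues a j := by
  symm
  refine Submodule.eq_of_le_of_finrank_eq ?_ ?_
  · intro v hv
    rw [LinearMap.BilinForm.mem_orthogonal_iff]
    intro u hu
    exact (sum_smul_dualForm_pow_eq_zero_iff a d q).1 hrel _ (hij ▸ mul_mem_formValues hu hv)
  · have := finrank_formValues_add_finrank_orthogonal (a := a) hd i
    omega

end Duality

/-- A form of positive degree is a combination of the variables. -/
lemma exists_eq_sum_X_mul {K : Type} [Field K] {k j : ℕ} {g : MvPolynomial (Fin k) K}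
    (hg : g ∈ homogeneousSubmodule (Fin k) K (j + 1)) :
    ∃ c : Fin k → MvPolynomial (Fin k) K,
      (∀ x, c x ∈ homogeneousSubmodule (Fin k) K j) ∧ g = ∑ x, X x * c x := by
  have hg0 : g ∈ idealOfVars (Fin k) K := by
    rw [← pow_one (idealOfVars (Fin k) K), mem_pow_idealOfVars_iff]
    intro s hs
    have := (mem_homogeneousSubmodule _ g).1 hg (mem_support_iff.1 hs)
    have hs' : s.degree = j + 1 := by rwa [Finsupp.degree_eq_weight_one]
    omega
  obtain ⟨c, hc⟩ := (Ideal.mem_span_range_iff_exists_fun).1 hg0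
  refine ⟨fun x => homogeneousComponent j (c x), fun x => homogeneousComponent_mem j _, ?_⟩
  rw [← homogeneousComponent_eq_self hg, ← hc, map_sum]
  refine Finset.sum_congr rfl fun x _ => ?_
  rw [mul_comm, homogeneousComponent_mul_left (isHomogeneous_X K x)]

section Gorenstein

variable {K : Type} [Field K] [CharZero K] {k m : ℕ} {a : Fin m → Fin k → K} {d : Fin m → K}
  {I : Ideal (MvPolynomial (Fin k) K)}

/-- The socle of `R/(I, ℓ)` vanishes in degrees other than `q + 1`. -/
lemma mem_sup_span_of_X_mul_mem (hI : ∀ f, f ∈ I ↔ ∀ i, ∀ t : K, eval (t • a i) f = 0)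
    (hd : ∀ i, d i ≠ 0) {q : ℕ}
    (hrel : ∑ i, d i • dualForm (a i) ^ q = 0)
    (htop : ∀ j, q < j → formValues a j = ⊤)
    (hdim : ∀ i j, i + j = q →
      Module.finrank K (formValues a i) + Module.finrank K (formValues a j) = m)
    {ℓ : MvPolynomial (Fin k) K} (hℓ : ℓ ∈ homogeneousSubmodule (Fin k) K 1)
    (hℓ0 : ∀ i, eval (a i) ℓ ≠ 0) {j : ℕ} (hj : j ≠ q + 1) {f : MvPolynomial (Fin k) K}
    (hf : f ∈ homogeneousSubmodule (Fin k) K j) (hX : ∀ x, X x * f ∈ I ⊔ Ideal.span {ℓ}) :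
    f ∈ I ⊔ Ideal.span {ℓ} := by
  rw [mem_sup_span_iff hI hℓ hf]
  set w := evalPoints a ℓ with hw
  have hw0 (i : Fin m) : w i ≠ 0 := by simpa [hw] using hℓ0 i
  have hdiv (v : Fin m → K) : w * (w⁻¹ * v) = v := by
    funext i
    simp [hw0 i]
  have hprod (x : Fin k) : w⁻¹ * evalPoints a (X x * f) ∈ formValues a j := by
    have hXf : X x * f ∈ homogeneousSubmodule (Fin k) K (j + 1) := by
      rw [add_comm]
      exact IsHomogeneous.mul (isHomogeneous_X K x) hf
    obtain ⟨v, hv, hvx⟩ := (mem_sup_span_iff hI hℓ hXf).1 (hX x)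
    have hvx' : w * v = evalPoints a (X x * f) := hvx
    have hv' : w⁻¹ * (w * v) = v := by
      funext i
      simp [hw0 i]
    rwa [← hvx', hv']
  have hfv : w⁻¹ * evalPoints a f ∈ (diagForm d).orthogonal (formValues a (q + 1 - j)) ∨
      q + 1 < j := by
    rcases lt_or_gt_of_ne hj with hlt | hgt
    · left
      obtain ⟨l, hl⟩ : ∃ l, q = j + l := ⟨q - j, by omega⟩
      have hl' : q + 1 - j = l + 1 := by omega
      rw [hl', LinearMap.BilinForm.mem_orthogonal_iff]
      rintro _ ⟨g, hg, rfl⟩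
      obtain ⟨c, hc, rfl⟩ := exists_eq_sum_X_mul hg
      rw [map_sum, map_sum, LinearMap.sum_apply]
      refine Finset.sum_eq_zero fun x _ => ?_
      have horth : evalPoints a (c x) ∈ (diagForm d).orthogonal (formValues a j) := by
        rw [orthogonal_formValues hd hl.symm hrel (hdim _ _ hl.symm)]
        exact evalPoints_mem_formValues a (hc x)
      rw [← LinearMap.BilinForm.mem_orthogonal_iff.1 horth _ (hprod x)]
      simp only [diagForm_apply]
      refine Finset.sum_congr rfl fun i _ => ?_
      simp only [AlgHom.toLinearMap_apply, map_mul, Pi.mul_apply]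
      ring
    · exact Or.inr hgt
  have hmem : j ≠ 0 → w⁻¹ * evalPoints a f ∈ formValues a (j - 1) := by
    intro hj0
    rcases hfv with h | h
    · by_cases hlt : q + 1 < j
      · rw [htop _ (by omega)]; trivial
      · rwa [orthogonal_formValues hd (by omega) hrel (hdim _ (j - 1) (by omega))] at h
    · rw [htop _ (by omega)]; trivial
  cases j with
  | zero =>
    have h := hfv.resolve_right (by omega)
    rw [htop _ (by omega)] at h
    have h0 : w⁻¹ * evalPoints a f = 0 := by
      refine (diagForm_nondegenerate hd).2 _ fun u => h u trivial
    rw [← hdiv (evalPoints a f), h0, mul_zero]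
    exact zero_mem _
  | succ j =>
    rw [← hdiv (evalPoints a f)]
    exact Submodule.mem_map_of_mem (f := LinearMap.mulLeft K w) (hmem (by omega))

end Gorenstein

/-- converse of the main theorem: if the powers `L_i^r` of the dual forms of
`Z` are linearly independent, there is a unique-up-to-scalar relation `∑ d_i L_i^{r−1} = 0`
with all `d_i ≠ 0`, and the `h`-vector of `Z` is symmetric, then `Z` is arithmetically
Gorenstein with `reg(R/I_Z) = r`. -/
theorem main_theorem_converse (K : Type) [Field K] [CharZero K] (n m r : ℕ)
    (a : Fin m → Fin (n + 1) → K) (ha : ∀ i, a i ≠ 0)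
    (hdist : ∀ i j, i ≠ j → ∀ t : K, a i ≠ t • a j)
    (I : Ideal (MvPolynomial (Fin (n + 1)) K))
    (hI : ∀ f, f ∈ I ↔ ∀ i, ∀ t : K, eval (t • a i) f = 0)
    (h1 : LinearIndependent K fun i => dualForm (a i) ^ r)
    (d : Fin m → K) (hd : ∀ i, d i ≠ 0)
    (hrel : (∑ i, d i • dualForm (a i) ^ (r - 1)) = 0)
    (huniq : ∀ e : Fin m → K, (∑ i, e i • dualForm (a i) ^ (r - 1)) = 0 →
      ∃ t : K, ∀ i, e i = t * d i)
    (ℓ : MvPolynomial (Fin (n + 1)) K) (hℓ1 : ℓ ∈ homogeneousSubmodule (Fin (n + 1)) K 1)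
    (hℓ : ∀ i, eval (a i) ℓ ≠ 0)
    (hsym : ∃ s : ℕ, IsGreatest {j : ℕ | HF (I ⊔ Ideal.span {ℓ}) j ≠ 0} s ∧
      ∀ j ≤ s, HF (I ⊔ Ideal.span {ℓ}) j = HF (I ⊔ Ideal.span {ℓ}) (s - j)) :
    (∀ ℓ' ∈ homogeneousSubmodule (Fin (n + 1)) K 1,
        (∀ i, eval (a i) ℓ' ≠ 0) → ArtinianGorenstein (I ⊔ Ideal.span {ℓ'})) ∧
      IsLeast {j : ℕ | HF I j = m} r := by
  have hm : 0 < m := by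
    obtain ⟨s, hs, -⟩ := hsym
    by_contra hm
    have hle := Submodule.finrank_le (formValues a s)
    have hadd := HF_sup_span_add hI hℓ1 s
    rw [Module.finrank_fin_fun] at hle
    have : HF (I ⊔ Ideal.span {ℓ}) s ≠ 0 := hs.1
    omega
  obtain ⟨q, rfl⟩ : ∃ q, r = q + 1 := by
    refine Nat.exists_eq_succ_of_ne_zero fun hr => ?_
    subst hr
    exact hd ⟨0, hm⟩ (Fintype.linearIndependent_iff.1 h1 d hrel _)
  rw [Nat.add_sub_cancel] at hrel huniq
  have hmono := monotone_finrank_formValues (a := a) hℓ1 hℓ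
  have htop_r : formValues a (q + 1) = ⊤ := formValues_eq_top hd h1
  have hfin_le (j : ℕ) : Module.finrank K (formValues a j) ≤ m := by
    simpa using Submodule.finrank_le (formValues a j)
  have hfin_r : Module.finrank K (formValues a (q + 1)) = m := by
    rw [htop_r, finrank_top, Module.finrank_fin_fun]
  have hfin_top (j : ℕ) (hj : q < j) : Module.finrank K (formValues a j) = m :=
    le_antisymm (hfin_le j) (hfin_r.symm.trans_le (hmono (Nat.succ_le_of_lt hj)))
  have htop (j : ℕ) (hj : q < j) : formValues a j = ⊤ :=
    Submodule.eq_top_of_finrank_eq (by rw [hfin_top j hj, Module.finrank_fin_fun])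
  have hfin_q : Module.finrank K (formValues a q) + 1 = m :=
    finrank_formValues_add_one hd hm hrel huniq
  have hHF_one {ℓ' : MvPolynomial (Fin (n + 1)) K}
      (hℓ' : ℓ' ∈ homogeneousSubmodule (Fin (n + 1)) K 1) (hℓ'0 : ∀ i, eval (a i) ℓ' ≠ 0) :
      HF (I ⊔ Ideal.span {ℓ'}) (q + 1) = 1 := by
    have := HF_sup_span_add hI hℓ' (q + 1)
    rw [finrank_multipleValues_succ a hℓ'0] at this
    omega
  have hHF_zero (j : ℕ) (hj : q + 1 < j) : HF (I ⊔ Ideal.span {ℓ}) j = 0 := by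
    obtain ⟨j, rfl⟩ := Nat.exists_eq_succ_of_ne_zero (Nat.ne_zero_of_lt hj)
    have := HF_sup_span_add hI hℓ1 (j + 1)
    rw [finrank_multipleValues_succ a hℓ, hfin_top j (by omega),
      hfin_top (j + 1) (by omega)] at this
    rw [Nat.succ_eq_add_one]
    omega
  have hdim (i j : ℕ) (hij : i + j = q) :
      Module.finrank K (formValues a i) + Module.finrank K (formValues a j) = m := by
    obtain ⟨s, ⟨hs, hs_ub⟩, hs_symm⟩ := hsym
    have hsq : s = q + 1 := by
      refine le_antisymm ?_ (hs_ub ?_)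
      · by_contra hlt
        exact hs (hHF_zero s (by omega))
      · simp [hHF_one hℓ1 hℓ]
    subst hsq
    refine Eq.trans ?_ hfin_r
    rw [← sum_range_HF_sup_span hI hℓ1 hℓ i, ← sum_range_HF_sup_span hI hℓ1 hℓ j,
      ← sum_range_HF_sup_span hI hℓ1 hℓ (q + 1),
      show q + 1 + 1 = (i + 1) + (j + 1) by omega, Finset.sum_range_add _ (i + 1) (j + 1),
      add_right_inj, ← Finset.sum_range_reflect _ (j + 1)]
    refine Finset.sum_congr rfl fun x hx => ?_
    have hx' := Finset.mem_range.1 hx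
    rw [hs_symm _ (by omega)]
    congr 1
    omega
  refine ⟨fun ℓ' hℓ' hℓ'0 => ?_, ?_, ?_⟩
  · have hJ (j : ℕ) (hj : q + 1 < j) (f : MvPolynomial (Fin (n + 1)) K)
        (hf : f ∈ homogeneousSubmodule (Fin (n + 1)) K j) : f ∈ I ⊔ Ideal.span {ℓ'} := by
      obtain ⟨j, rfl⟩ := Nat.exists_eq_succ_of_ne_zero (Nat.ne_zero_of_lt hj)
      have hmult : multipleValues a ℓ' (j + 1) = ⊤ := by
        refine Submodule.eq_top_of_finrank_eq ?_
        rw [finrank_multipleValues_succ a hℓ'0, hfin_top j (by omega), Module.finrank_fin_fun]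
      rw [mem_sup_span_iff hI hℓ' hf, Nat.succ_eq_add_one, hmult]
      trivial
    refine ⟨finiteDimensional_quotient_of_homogeneousSubmodule_le hJ, ?_⟩
    rw [socle_eq_map_homogeneousSubmodule
      (fun f hf j => homogeneousComponent_mem_sup_span hI hℓ' hf j)
      (fun j hj f hf hX => mem_sup_span_of_X_mul_mem hI hd hrel htop hdim hℓ' hℓ'0 hj hf hX)
      (fun f hf => hJ _ (Nat.lt_succ_self _) f hf)]
    exact hHF_one hℓ' hℓ'0
  · rw [Set.mem_ofPred_eq, HF_eq_finrank_formValues hI, hfin_r]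
  · intro j hj
    rw [Set.mem_ofPred_eq, HF_eq_finrank_formValues hI] at hj
    by_contra hlt
    have : Module.finrank K (formValues a j) ≤ Module.finrank K (formValues a q) :=
      hmono (by omega)
    omega
end
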